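/- The functional V₂(u) := ∬ log(1 + 1/|x−y|) u²(x)u²(y) dxdy is of class C¹ on L^{8/3}(ℝ²), and its Fréchet derivative is given by V₂'(u)[v] = 4 B₂(u², uv) = 4 ∬ log(1+1/|x−y|) u²(x) u(y) v(y) dxdy for all u, v ∈ L^{8/3}(ℝ²); in particular V₂'(u)[u] = 4 V₂(u). -/

import Mathlib

noncomputable section

open MeasureTheory Real

abbrev R2 : Type := EuclideanSpace ℝ (Fin 2)

instance : Fact ((1 : ENNReal) ≤ ENNReal.ofReal (8 / 3)) :=
  ⟨by rw [show (1 : ENNReal) = ENNReal.ofReal 1 by simp]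
      exact ENNReal.ofReal_le_ofReal (by norm_num)⟩

/-- The Banach space `L^{8/3}(ℝ²)`. -/
abbrev L83 : Type := Lp (α := R2) ℝ (ENNReal.ofReal (8 / 3)) (volume : Measure R2)

/-- The functional `V₂` on `L^{8/3}(ℝ²)`. -/
def V2 (u : L83) : ℝ :=
  ∫ x : R2, ∫ y : R2, Real.log (1 + 1 / ‖x - y‖) * (u x) ^ 2 * (u y) ^ 2


def c2 : ℝ := 2 * (volume : Measure R2).real (Metric.ball 0 1)

lemma c2_nonneg : 0 ≤ c2 := by unfold c2; positivity

lemma near_int (R : ℝ) (hR : 0 < R) :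
    ∫⁻ z : R2, ENNReal.ofReal ((Set.Iio R).indicator (fun r => r⁻¹) ‖z‖) = ENNReal.ofReal (c2 * R) := by
  have e : Set.EqOn (fun y : ℝ => y ^ (Module.finrank ℝ R2 - 1) • (Set.Iio R).indicator (fun r => r⁻¹) y)
      ((Set.Iio R).indicator 1) (Set.Ioi 0) := by
    intro y hy
    have : y ≠ 0 := ne_of_gt hy
    by_cases h : y < R <;> simp [Set.indicator, h, this]
  have hs : (Set.Iio R ∩ Set.Ioi 0) = Set.Ioo 0 R := by ext; simp [and_comm]
  rw [← ofReal_integral_eq_lintegral_ofReal]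
  · rw [integral_fun_norm_addHaar volume ((Set.Iio R).indicator (fun r => r⁻¹)),
      setIntegral_congr_fun measurableSet_Ioi e, integral_indicator_one measurableSet_Iio]
    simp [measureReal_def, Measure.restrict_apply, hs, c2, hR.le]
    ring_nf
  · rw [integrable_fun_norm_addHaar volume (f := (Set.Iio R).indicator (fun r => r⁻¹)),
      integrableOn_congr_fun e measurableSet_Ioi, IntegrableOn,
      integrable_indicator_iff measurableSet_Iio, IntegrableOn,
      Measure.restrict_restrict measurableSet_Iio, hs]
    exact integrableOn_const (by simp)
  · filter_upwards with z
    by_cases h : ‖z‖ < R <;> simp [Set.indicator, h]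

lemma far_int (R : ℝ) (hR : 0 < R) :
    ∫⁻ z : R2, ENNReal.ofReal ((Set.Ioi R).indicator (fun r => r ^ (-4:ℝ)) ‖z‖)
      = ENNReal.ofReal (c2 * (R ^ (-2:ℝ) / 2)) := by
  have e : Set.EqOn (fun y : ℝ => y ^ (Module.finrank ℝ R2 - 1) • (Set.Ioi R).indicator (fun r => r ^ (-4:ℝ)) y)
      ((Set.Ioi R).indicator (fun r => r ^ (-3:ℝ))) (Set.Ioi 0) := by
    intro y hy
    have hy : 0 < y := hy
    by_cases h : R < y
    · simp only [finrank_euclideanSpace, Fintype.card_fin, Set.indicator, Set.mem_Ioi, h, if_true, smul_eq_mul]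
      rw [show (-3:ℝ) = 1 + -4 by norm_num, Real.rpow_add hy, Real.rpow_one]
      norm_num
    · simp [Set.indicator, h]
  have hs : (Set.Ioi R ∩ Set.Ioi 0) = Set.Ioi R := by
    ext y; simp; intro h; linarith
  rw [← ofReal_integral_eq_lintegral_ofReal]
  · rw [integral_fun_norm_addHaar volume ((Set.Ioi R).indicator (fun r => r ^ (-4:ℝ))),
      setIntegral_congr_fun measurableSet_Ioi e, integral_indicator measurableSet_Ioi,
      Measure.restrict_restrict measurableSet_Ioi, hs, integral_Ioi_rpow_of_lt (by norm_num) hR]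
    simp [c2]
    norm_num
    ring_nf
  · rw [integrable_fun_norm_addHaar volume (f := (Set.Ioi R).indicator (fun r => r ^ (-4:ℝ))),
      integrableOn_congr_fun e measurableSet_Ioi, IntegrableOn,
      integrable_indicator_iff measurableSet_Ioi, IntegrableOn,
      Measure.restrict_restrict measurableSet_Ioi, hs]
    exact integrableOn_Ioi_rpow_of_lt (by norm_num) hR
  · filter_upwards with z
    by_cases h : R < ‖z‖ <;> simp [Set.indicator, h]

open scoped ENNReal

def kk (z : R2) : ℝ≥0∞ := ENNReal.ofReal (‖z‖⁻¹)

lemma kk_meas : Measurable kk := by unfold kk; fun_prop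

def C0 : ℝ≥0∞ := ENNReal.ofReal c2 + (ENNReal.ofReal (c2 / 2)) ^ (1/4:ℝ)

lemma one_side (g : R2 → ℝ≥0∞) (hg : Measurable g) (hg1 : ∫⁻ y, g y ^ (4/3:ℝ) ≤ 1) (x : R2)
    (t : ℝ≥0∞) (ht : t ≠ ∞) :
    ∫⁻ y, min (g y) t * kk (x - y) ≤ C0 * t ^ (1/3:ℝ) := by
  rcases eq_or_ne t 0 with rfl | ht0
  · simp
  lift t to NNReal using ht
  have ht0 : 0 < (t:ℝ) := by
    have : t ≠ 0 := by simpa using ht0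
    positivity
  set R : ℝ := (t:ℝ) ^ (-2/3:ℝ) with hRdef
  have hR : 0 < R := by positivity
  set n : R2 → ℝ≥0∞ := fun z => ENNReal.ofReal ((Set.Iio R).indicator (fun r => r⁻¹) ‖z‖)
  set F : R2 → ℝ≥0∞ := fun z => ENNReal.ofReal ((Set.Ici R).indicator (fun r => r⁻¹) ‖z‖)
  have hnm : Measurable n := by
    apply ENNReal.measurable_ofReal.comp
    exact (measurable_inv.indicator measurableSet_Iio).comp measurable_norm
  have hFm : Measurable F := by
    apply ENNReal.measurable_ofReal.comp
    exact (measurable_inv.indicator measurableSet_Ici).comp measurable_norm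
  have h1 : ∀ y, min (g y) t * kk (x - y) ≤ t * n (x - y) + (g * fun y => F (x - y)) y := by
    intro y
    by_cases h : ‖x - y‖ < R
    · have : n (x - y) = kk (x - y) := by simp [n, kk, Set.indicator, h]
      rw [this]
      exact le_trans (mul_le_mul_left (min_le_right _ _) _) le_self_add
    · have : F (x - y) = kk (x - y) := by simp [F, kk, Set.indicator, not_lt.1 h]
      simp only [Pi.mul_apply]
      rw [this]
      exact le_trans (mul_le_mul_left (min_le_left _ _) _) le_add_self
  have hF4 : ∫⁻ y, F (x - y) ^ (4:ℝ) ≤ ENNReal.ofReal (c2 * (R ^ (-2:ℝ) / 2)) := by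
    rw [lintegral_sub_left_eq_self (fun z => F z ^ (4:ℝ)) x, ← far_int R hR]
    apply le_of_eq
    apply lintegral_congr_ae
    have : ∀ᵐ z : R2, ‖z‖ ≠ R := by
      have := Measure.addHaar_sphere (volume : Measure R2) 0 R
      rw [ae_iff]
      convert this using 2
      ext z; simp
    filter_upwards [this] with z hz
    have hp : 0 ≤ ‖z‖ := norm_nonneg _
    rcases lt_or_gt_of_ne hz with h | h
    · simp [F, Set.indicator, h.not_ge, h.not_gt]
    · simp only [F, Set.indicator, Set.mem_Ici, h.le, if_true, Set.mem_Ioi, h]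
      rw [ENNReal.ofReal_rpow_of_nonneg (by positivity) (by norm_num), Real.inv_rpow hp, ← Real.rpow_neg hp]
  calc ∫⁻ y, min (g y) t * kk (x - y) 
      ≤ ∫⁻ y, (t * n (x - y) + (g * fun y => F (x - y)) y) := lintegral_mono h1
    _ = t * ENNReal.ofReal (c2 * R) + ∫⁻ y, (g * fun y => F (x - y)) y := by
        rw [lintegral_add_left (by fun_prop), lintegral_const_mul _ (by fun_prop),
          lintegral_sub_left_eq_self n x, near_int R hR]
    _ ≤ t * ENNReal.ofReal (c2 * R) + 
          (∫⁻ y, g y ^ (4/3:ℝ)) ^ (1/(4/3):ℝ) * (∫⁻ y, F (x - y) ^ (4:ℝ)) ^ (1/4:ℝ) := by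
        gcongr
        exact ENNReal.lintegral_mul_le_Lp_mul_Lq volume
          (Real.holderConjugate_iff.2 ⟨by norm_num, by norm_num⟩) (by fun_prop) (by fun_prop)
    _ ≤ t * ENNReal.ofReal (c2 * R) + 1 ^ (1/(4/3):ℝ) * (ENNReal.ofReal (c2 * (R ^ (-2:ℝ) / 2))) ^ (1/4:ℝ) := by
        gcongr
    _ = C0 * t ^ (1/3:ℝ) := by
        have e1 : (t:ℝ) * R = (t:ℝ) ^ (1/3:ℝ) := by
          rw [hRdef, ← Real.rpow_one_add' ht0.le (by norm_num)]; norm_num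
        have e2 : R ^ (-2:ℝ) = ((t:ℝ) ^ (1/3:ℝ)) ^ (4:ℝ) := by
          rw [hRdef, ← Real.rpow_mul ht0.le, ← Real.rpow_mul ht0.le]; norm_num
        have e3 : (t:ℝ≥0∞) ^ (1/3:ℝ) = ENNReal.ofReal ((t:ℝ) ^ (1/3:ℝ)) := by
          rw [← ENNReal.ofReal_rpow_of_pos ht0]; simp
        have hc := c2_nonneg
        rw [C0, add_mul, e3, ENNReal.one_rpow, one_mul]
        congr 1
        · rw [← ENNReal.ofReal_mul hc, ← e1, ← ENNReal.ofReal_coe_nnreal, ← ENNReal.ofReal_mul ht0.le]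
          ring_nf
        · rw [e2, show c2 * (((t:ℝ) ^ (1/3:ℝ)) ^ (4:ℝ) / 2) = c2 / 2 * ((t:ℝ) ^ (1/3:ℝ)) ^ (4:ℝ) by ring,
            ENNReal.ofReal_mul (by positivity), ENNReal.mul_rpow_of_nonneg _ _ (by norm_num),
            ← ENNReal.ofReal_rpow_of_nonneg (p := 4) (by positivity) (by norm_num), ← ENNReal.rpow_mul]
          norm_num

lemma hls_norm (f g : R2 → ℝ≥0∞) (hf : Measurable f) (hg : Measurable g)
    (hf' : ∀ x, f x ≠ ∞) (hg' : ∀ x, g x ≠ ∞)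
    (hf1 : ∫⁻ y, f y ^ (4/3:ℝ) ≤ 1) (hg1 : ∫⁻ y, g y ^ (4/3:ℝ) ≤ 1) :
    ∫⁻ x, ∫⁻ y, f x * g y * kk (x - y) ≤ 2 * C0 := by
  have hk := kk_meas
  have key : ∀ f g : R2 → ℝ≥0∞, Measurable f → Measurable g → (∀ x, f x ≠ ∞) →
      (∫⁻ y, f y ^ (4/3:ℝ) ≤ 1) → (∫⁻ y, g y ^ (4/3:ℝ) ≤ 1) →
      ∫⁻ x, ∫⁻ y, f x * (min (g y) (f x) * kk (x - y)) ≤ C0 := by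
    intro f g hf hg hf' hf1 hg1
    calc ∫⁻ x, ∫⁻ y, f x * (min (g y) (f x) * kk (x - y)) 
        ≤ ∫⁻ x, C0 * f x ^ (4/3:ℝ) := by
          apply lintegral_mono
          intro x
          simp only
          rw [lintegral_const_mul _ (by fun_prop)]
          calc _ ≤ f x * (C0 * f x ^ (1/3:ℝ)) := by
                gcongr
                exact one_side g hg hg1 x _ (hf' x)
            _ = C0 * f x ^ (4/3:ℝ) := by
                rw [show (4/3:ℝ) = 1 + 1/3 by norm_num,
                  ENNReal.rpow_add_of_nonneg _ _ (by norm_num) (by norm_num), ENNReal.rpow_one]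
                ring
      _ = C0 * ∫⁻ x, f x ^ (4/3:ℝ) := lintegral_const_mul _ (by fun_prop)
      _ ≤ C0 * 1 := by gcongr
      _ = C0 := mul_one _
  have hsym : ∀ z, kk (-z) = kk z := by intro z; simp [kk]
  calc ∫⁻ x, ∫⁻ y, f x * g y * kk (x - y)
      ≤ ∫⁻ x, ∫⁻ y, (f x * (min (g y) (f x) * kk (x - y)) + g y * (min (f x) (g y) * kk (y - x))) := by
        apply lintegral_mono; intro x; apply lintegral_mono; intro y
        simp only
        rw [← hsym (x - y), neg_sub]
        rcases le_total (g y) (f x) with h | h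
        · rw [min_eq_left h, ← mul_assoc]; exact le_self_add
        · rw [min_eq_left h, ← mul_assoc (g y), mul_comm (g y)]; exact le_add_self
    _ = (∫⁻ x, ∫⁻ y, f x * (min (g y) (f x) * kk (x - y))) 
        + ∫⁻ x, ∫⁻ y, g y * (min (f x) (g y) * kk (y - x)) := by
        rw [← lintegral_add_left]
        · apply lintegral_congr; intro x
          rw [lintegral_add_left (by fun_prop)]
        · apply Measurable.lintegral_prod_right'
            (f := fun p : R2 × R2 => f p.1 * (min (g p.2) (f p.1) * kk (p.1 - p.2)))
          fun_prop
    _ ≤ C0 + C0 := by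
        gcongr
        · exact key f g hf hg hf' hf1 hg1
        · rw [lintegral_lintegral_swap (by
            apply Measurable.aemeasurable; unfold Function.uncurry; fun_prop)]
          exact key g f hg hf hg' hg1 hf1
    _ = 2 * C0 := (two_mul _).symm

instance fact43 : Fact ((1 : ENNReal) ≤ ENNReal.ofReal (4 / 3)) :=
  ⟨by rw [show (1 : ENNReal) = ENNReal.ofReal 1 by simp]
      exact ENNReal.ofReal_le_ofReal (by norm_num)⟩

abbrev L43 : Type := Lp (α := R2) ℝ (ENNReal.ofReal (4 / 3)) (volume : Measure R2)

instance holder83 : ENNReal.HolderTriple (ENNReal.ofReal (8/3)) (ENNReal.ofReal (8/3))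
    (ENNReal.ofReal (4/3)) := ⟨by
  rw [← ENNReal.ofReal_inv_of_pos (by norm_num), ← ENNReal.ofReal_inv_of_pos (by norm_num),
    ← ENNReal.ofReal_add (by norm_num) (by norm_num)]
  norm_num⟩

lemma C0_ne_top : C0 ≠ ∞ := by
  unfold C0
  refine ENNReal.add_ne_top.2 ⟨by simp, ENNReal.rpow_ne_top_of_nonneg (by norm_num) (by simp)⟩

lemma enorm_L43 (f : L43) : ∫⁻ x, ‖f x‖ₑ ^ (4/3:ℝ) = ‖f‖ₑ ^ (4/3:ℝ) := by
  rw [Lp.enorm_def, eLpNorm_eq_lintegral_rpow_enorm_toReal (by simp) (by simp),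
    ENNReal.toReal_ofReal (by norm_num), ← ENNReal.rpow_mul]
  norm_num

lemma hls_Lp (f g : L43) :
    ∫⁻ x, ∫⁻ y, ‖f x‖ₑ * ‖g y‖ₑ * kk (x - y) ≤ 2 * C0 * ‖f‖ₑ * ‖g‖ₑ := by
  have hk := kk_meas
  have mf : Measurable fun x => ‖f x‖ₑ := (Lp.stronglyMeasurable f).measurable.enorm
  have mg : Measurable fun x => ‖g x‖ₑ := (Lp.stronglyMeasurable g).measurable.enorm
  by_cases hf0 : f = 0
  · subst hf0
    have h0 : (fun x => ∫⁻ y, ‖(0 : L43) x‖ₑ * ‖g y‖ₑ * kk (x - y)) =ᵐ[volume] fun _ => 0 := by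
      filter_upwards [Lp.coeFn_zero ℝ (ENNReal.ofReal (4/3)) (volume : Measure R2)] with x hx
      simp [hx]
    rw [lintegral_congr_ae h0]; simp
  by_cases hg0 : g = 0
  · subst hg0
    have h0 : ∀ x, ∫⁻ y, ‖f x‖ₑ * ‖(0 : L43) y‖ₑ * kk (x - y) = 0 := by
      intro x
      rw [← lintegral_zero (μ := (volume : Measure R2))]
      apply lintegral_congr_ae
      filter_upwards [Lp.coeFn_zero ℝ (ENNReal.ofReal (4/3)) (volume : Measure R2)] with y hy
      simp [hy]
    simp [h0]
  have a0 : ‖f‖ₑ ≠ 0 := by simpa using hf0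
  have b0 : ‖g‖ₑ ≠ 0 := by simpa using hg0
  have at' : ‖f‖ₑ ≠ ∞ := enorm_ne_top
  have bt' : ‖g‖ₑ ≠ ∞ := enorm_ne_top
  have nrm : ∀ h : L43, ‖h‖ₑ ≠ 0 → ∫⁻ x, (‖h‖ₑ⁻¹ * ‖h x‖ₑ) ^ (4/3:ℝ) ≤ 1 := by
    intro h hh
    have mh : Measurable fun x => ‖h x‖ₑ := (Lp.stronglyMeasurable h).measurable.enorm
    simp_rw [ENNReal.mul_rpow_of_nonneg _ _ (show (0:ℝ) ≤ 4/3 by norm_num)]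
    rw [lintegral_const_mul _ (by fun_prop), enorm_L43, ← ENNReal.mul_rpow_of_nonneg _ _ (by norm_num),
      ENNReal.inv_mul_cancel hh enorm_ne_top, ENNReal.one_rpow]
  have key := hls_norm (fun x => ‖f‖ₑ⁻¹ * ‖f x‖ₑ) (fun x => ‖g‖ₑ⁻¹ * ‖g x‖ₑ)
    (by fun_prop) (by fun_prop)
    (fun x => ENNReal.mul_ne_top (by simpa using a0) enorm_ne_top)
    (fun x => ENNReal.mul_ne_top (by simpa using b0) enorm_ne_top) (nrm f a0) (nrm g b0)
  calc ∫⁻ x, ∫⁻ y, ‖f x‖ₑ * ‖g y‖ₑ * kk (x - y) 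
      = ∫⁻ x, ∫⁻ y, (‖f‖ₑ * ‖g‖ₑ) * ((‖f‖ₑ⁻¹ * ‖f x‖ₑ) * (‖g‖ₑ⁻¹ * ‖g y‖ₑ) * kk (x - y)) := by
        congr! 4 with x y
        calc _ = (‖f‖ₑ * ‖f‖ₑ⁻¹) * (‖g‖ₑ * ‖g‖ₑ⁻¹) * (‖f x‖ₑ * ‖g y‖ₑ * kk (x - y)) := by
              rw [ENNReal.mul_inv_cancel a0 at', ENNReal.mul_inv_cancel b0 bt']; simp
          _ = _ := by ring
    _ = (‖f‖ₑ * ‖g‖ₑ) * ∫⁻ x, ∫⁻ y, ((‖f‖ₑ⁻¹ * ‖f x‖ₑ) * (‖g‖ₑ⁻¹ * ‖g y‖ₑ) * kk (x - y)) := by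
        have hne : ‖f‖ₑ * ‖g‖ₑ ≠ ∞ := ENNReal.mul_ne_top at' bt'
        simp_rw [lintegral_const_mul' _ _ hne]
    _ ≤ (‖f‖ₑ * ‖g‖ₑ) * (2 * C0) := by gcongr
    _ = _ := by ring

def GG (f g : R2 → ℝ) (p : R2 × R2) : ℝ := Real.log (1 + 1 / ‖p.1 - p.2‖) * f p.1 * g p.2

lemma GG_meas (f g : L43) : Measurable (GG f g) := by
  have mf : Measurable f := (Lp.stronglyMeasurable f).measurable
  have mg : Measurable g := (Lp.stronglyMeasurable g).measurable
  unfold GG; fun_prop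

lemma GG_lint (f g : L43) :
    ∫⁻ p, ‖GG f g p‖ₑ ∂((volume : Measure R2).prod volume) ≤ 2 * C0 * ‖f‖ₑ * ‖g‖ₑ := by
  refine le_trans ?_ (hls_Lp f g)
  rw [lintegral_prod _ (GG_meas f g).enorm.aemeasurable]
  gcongr with x y
  simp only [GG, enorm_mul]
  rw [mul_assoc, mul_comm]
  gcongr
  unfold kk
  have hp : 0 ≤ ‖x - y‖⁻¹ := by positivity
  rw [one_div, Real.enorm_eq_ofReal (Real.log_nonneg (by linarith))]
  apply ENNReal.ofReal_le_ofReal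
  have := Real.log_le_sub_one_of_pos (x := 1 + ‖x - y‖⁻¹) (by linarith)
  linarith

lemma GG_integrable (f g : L43) : Integrable (GG f g) ((volume : Measure R2).prod volume) :=
  ⟨(GG_meas f g).aestronglyMeasurable, lt_of_le_of_lt (GG_lint f g) (by
    have := C0_ne_top
    exact ENNReal.mul_lt_top (ENNReal.mul_lt_top (ENNReal.mul_lt_top (by simp) this.lt_top)
      enorm_lt_top) enorm_lt_top)⟩

lemma GG_congr {f f' g g' : R2 → ℝ} (hf : f =ᵐ[volume] f') (hg : g =ᵐ[volume] g') :
    GG f g =ᵐ[(volume : Measure R2).prod volume] GG f' g' := by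
  have h1 := (Measure.quasiMeasurePreserving_fst (μ := (volume : Measure R2)) 
    (ν := (volume : Measure R2))).ae hf
  have h2 := (Measure.quasiMeasurePreserving_snd (μ := (volume : Measure R2)) 
    (ν := (volume : Measure R2))).ae hg
  filter_upwards [h1, h2] with p h1 h2
  simp [GG, h1, h2]

def BI (f g : R2 → ℝ) : ℝ := ∫ p, GG f g p ∂((volume : Measure R2).prod volume)

lemma BI_congr {f f' g g' : R2 → ℝ} (hf : f =ᵐ[volume] f') (hg : g =ᵐ[volume] g') :
    BI f g = BI f' g' := integral_congr_ae (GG_congr hf hg)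

def BL : L43 →ₗ[ℝ] L43 →ₗ[ℝ] ℝ := LinearMap.mk₂ ℝ (fun f g => BI f g)
  (by
    intro f f' g
    rw [BI_congr (Lp.coeFn_add f f') (ae_eq_refl g), BI, BI, BI,
      ← integral_add (GG_integrable f g) (GG_integrable f' g)]
    congr 1; ext p; simp [GG]; ring)
  (by
    intro c f g
    rw [BI_congr (Lp.coeFn_smul c f) (ae_eq_refl g), BI, BI, ← integral_smul]
    congr 1; ext p; simp [GG]; ring)
  (by
    intro f g g'
    rw [BI_congr (ae_eq_refl f) (Lp.coeFn_add g g'), BI, BI, BI,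
      ← integral_add (GG_integrable f g) (GG_integrable f g')]
    congr 1; ext p; simp [GG]; ring)
  (by
    intro c f g
    rw [BI_congr (ae_eq_refl f) (Lp.coeFn_smul c g), BI, BI, ← integral_smul]
    congr 1; ext p; simp [GG]; ring)

lemma BL_bound (f g : L43) : ‖BL f g‖ ≤ (2 * C0).toReal * ‖f‖ * ‖g‖ := by
  have h : ‖BL f g‖ₑ ≤ 2 * C0 * ‖f‖ₑ * ‖g‖ₑ :=
    (enorm_integral_le_lintegral_enorm _).trans (GG_lint f g)
  have h2 := ENNReal.toReal_mono (by
    have := C0_ne_top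
    exact (ENNReal.mul_lt_top (ENNReal.mul_lt_top (ENNReal.mul_lt_top (by simp) this.lt_top)
      enorm_lt_top) enorm_lt_top).ne) h
  rw [ENNReal.toReal_mul, ENNReal.toReal_mul (a := 2 * C0)] at h2
  simpa only [toReal_enorm] using h2

def BC : L43 →L[ℝ] L43 →L[ℝ] ℝ := BL.mkContinuous₂ _ BL_bound

lemma BC_apply (f g : L43) : BC f g = BI f g := rfl

lemma BC_symm (f g : L43) : BC f g = BC g f := by
  rw [BC_apply, BC_apply, BI, BI, ← integral_prod_swap]
  congr 1; ext p
  simp only [GG, Prod.fst_swap, Prod.snd_swap, norm_sub_rev p.2 p.1]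
  ring

def PC : L83 →L[ℝ] L83 →L[ℝ] L43 :=
  (ContinuousLinearMap.mul ℝ ℝ).holderL volume (ENNReal.ofReal (8/3)) (ENNReal.ofReal (8/3))
    (ENNReal.ofReal (4/3))

lemma PC_ae (u v : L83) : PC u v =ᵐ[volume] fun x => u x * v x :=
  (ContinuousLinearMap.mul ℝ ℝ).coeFn_holder u v

lemma PC_symm (u v : L83) : PC u v = PC v u := by
  apply Lp.ext
  filter_upwards [PC_ae u v, PC_ae v u] with x h1 h2
  rw [h1, h2, mul_comm]

lemma BC_PC (a b c d : L83) : BC (PC a b) (PC c d) =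
    ∫ x : R2, ∫ y : R2, Real.log (1 + 1 / ‖x - y‖) * (a x * b x) * (c y * d y) := by
  have hi := (GG_integrable (PC a b) (PC c d)).congr (GG_congr (PC_ae a b) (PC_ae c d))
  rw [BC_apply, BI_congr (PC_ae a b) (PC_ae c d), BI, integral_prod _ hi]
  rfl

lemma V2_eq (u : L83) : V2 u = BC (PC u u) (PC u u) := by
  rw [BC_PC, V2]; simp only [sq]

/-- `V₂` is of class `C¹` on `L^{8/3}(ℝ²)` with derivative
`V₂'(u)[v] = 4 B₂(u², uv)`; in particular `V₂'(u)[u] = 4 V₂(u)`. -/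
theorem statement12 :
    ∃ D : L83 → (L83 →L[ℝ] ℝ),
      Continuous D ∧
      (∀ u : L83, HasFDerivAt V2 (D u) u) ∧
      (∀ u v : L83, D u v =
        4 * ∫ x : R2, ∫ y : R2, Real.log (1 + 1 / ‖x - y‖) * (u x) ^ 2 * (u y * v y)) ∧
      (∀ u : L83, D u u = 4 * V2 u) := by
  refine ⟨fun u => (4:ℝ) • (BC (PC u u)).comp (PC u), ?_, ?_, ?_, ?_⟩
  · fun_prop
  · intro u
    have hP := PC.hasFDerivAt_of_bilinear (hasFDerivAt_id u) (hasFDerivAt_id u)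
    have hB := BC.hasFDerivAt_of_bilinear hP hP
    have hV : V2 = fun u => BC (PC u u) (PC u u) := funext V2_eq
    rw [hV]
    refine hB.congr_fderiv ?_
    ext v
    simp [PC_symm v u, BC_symm (PC u v) (PC u u)]
    ring
  · intro u v
    have := BC_PC u u u v
    simp only [sq]
    rw [← this]
    simp
  · intro u
    rw [V2_eq]
    simp
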